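/- Let G be a 2-connected graph on n vertices. If every vertex of G except for at most one vertex has degree at least k, then the circumference of G satisfies c(G) ≥ min{2k, n}. -/

import Mathlib

open SimpleGraph

/-- `G` is (isomorphic to) a subgraph of `H`: there is an injective map preserving adjacency. -/
def IsSubgraphOf {α β : Type*} (G : SimpleGraph α) (H : SimpleGraph β) : Prop :=
  ∃ f : α ↪ β, ∀ ⦃a b : α⦄, G.Adj a b → H.Adj (f a) (f b)

/-- A graph is 2-connected if it has at least 3 vertices and deleting any single
vertex leaves it connected. -/
def TwoConnected {α : Type*} (G : SimpleGraph α) : Prop :=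
  3 ≤ Nat.card α ∧ ∀ v : α, (G.induce {u : α | u ≠ v}).Connected

/-- The circumference of a graph: the length of a longest cycle (0 if there is none). -/
noncomputable def circumference {α : Type*} (G : SimpleGraph α) : ℕ :=
  sSup {n : ℕ | ∃ (v : α) (w : G.Walk v v), w.IsCycle ∧ w.length = n}

/-- The degree of a vertex (as the cardinality of its neighborhood). -/
noncomputable def gdeg {α : Type*} (G : SimpleGraph α) (v : α) : ℕ :=
  (G.neighborSet v).ncard

/-- The join `G + H` of two graphs. -/
def graphJoin {α β : Type*} (G : SimpleGraph α) (H : SimpleGraph β) :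
    SimpleGraph (α ⊕ β) :=
  SimpleGraph.fromRel fun x y =>
    match x, y with
    | Sum.inl a, Sum.inl b => G.Adj a b
    | Sum.inr a, Sum.inr b => H.Adj a b
    | _, _ => True

/-- The disjoint union `G ∪ H` of two graphs. -/
def graphUnion {α β : Type*} (G : SimpleGraph α) (H : SimpleGraph β) :
    SimpleGraph (α ⊕ β) :=
  SimpleGraph.fromRel fun x y =>
    match x, y with
    | Sum.inl a, Sum.inl b => G.Adj a b
    | Sum.inr a, Sum.inr b => H.Adj a b
    | _, _ => False

/-- `cliques t m` is `t` vertex-disjoint copies of the complete graph `K_m`. -/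
def cliques (t m : ℕ) : SimpleGraph (Fin t × Fin m) :=
  SimpleGraph.fromRel fun x y => x.1 = y.1

/-- The graph `H(n, l, a)` on vertex partition `A ∪ B ∪ C` with `|A| = a`,
`|B| = n - l + a`, `|C| = l - 2a`, joining all pairs between `A` and `B` and
all pairs inside `A ∪ C`.  Here `A` consists of the indices `< a`, `B` of the
indices in `[a, n - l + 2a)` and `C` of the remaining indices. -/
def Hgraph (n l a : ℕ) : SimpleGraph (Fin n) :=
  SimpleGraph.fromRel fun i j =>
    ((i : ℕ) < a ∧ a ≤ (j : ℕ) ∧ (j : ℕ) < n - l + 2 * a) ∨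
    (((i : ℕ) < a ∨ n - l + 2 * a ≤ (i : ℕ)) ∧ ((j : ℕ) < a ∨ n - l + 2 * a ≤ (j : ℕ)))

/-- `M_t`: a matching with `⌊t/2⌋` edges on `t` vertices (plus an isolated vertex if `t` is odd). -/
def matchingGraph (t : ℕ) : SimpleGraph (Fin t) :=
  SimpleGraph.fromRel fun i j => (j : ℕ) = (i : ℕ) + 1 ∧ (i : ℕ) % 2 = 0

/-- `S_s = K_{1, s-1}`: the star on `s` vertices, with center `0`. -/
def starGraph (s : ℕ) : SimpleGraph (Fin s) :=
  SimpleGraph.fromRel fun i _ => (i : ℕ) = 0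

/-- `F(s, t, k)`: obtained from the disjoint graphs `K_3` (with vertices `x = 0`, `y = 1`,
`z = 2`), `sK_{k-1} ∪ K_1` and `tK_{k-1}`, joining `x` and `z` to every vertex of
`sK_{k-1} ∪ K_1` and joining `y` and `z` to every vertex of `tK_{k-1}`. -/
def Fgraph (s t k : ℕ) :
    SimpleGraph (Fin 3 ⊕ (((Fin s × Fin (k - 1)) ⊕ Fin 1) ⊕ (Fin t × Fin (k - 1)))) :=
  SimpleGraph.fromRel fun x y =>
    match x, y with
    | Sum.inl _, Sum.inl _ => True
    | Sum.inl i, Sum.inr (Sum.inl _) => i = 0 ∨ i = 2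
    | Sum.inl i, Sum.inr (Sum.inr _) => i = 1 ∨ i = 2
    | Sum.inr (Sum.inl (Sum.inl a)), Sum.inr (Sum.inl (Sum.inl b)) => a.1 = b.1
    | Sum.inr (Sum.inr a), Sum.inr (Sum.inr b) => a.1 = b.1
    | _, _ => False

/-- `F_1(t, k) = K_2 + (tK_{k-1} ∪ K_k ∪ K_1)`. -/
def F1graph (t k : ℕ) :
    SimpleGraph (Fin 2 ⊕ ((Fin t × Fin (k - 1)) ⊕ (Fin k ⊕ Fin 1))) :=
  graphJoin (⊤ : SimpleGraph (Fin 2))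
    (graphUnion (cliques t (k - 1))
      (graphUnion (⊤ : SimpleGraph (Fin k)) (⊤ : SimpleGraph (Fin 1))))

/-- The graph obtained from the cones `K_1 + G` and `K_1 + H` by joining the two apexes. -/
def joinCenters {α β : Type*} (G : SimpleGraph α) (H : SimpleGraph β) :
    SimpleGraph ((Fin 1 ⊕ α) ⊕ (Fin 1 ⊕ β)) :=
  SimpleGraph.fromRel fun x y =>
    match x, y with
    | Sum.inl a, Sum.inl b => (graphJoin (⊤ : SimpleGraph (Fin 1)) G).Adj a b
    | Sum.inr a, Sum.inr b => (graphJoin (⊤ : SimpleGraph (Fin 1)) H).Adj a b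
    | Sum.inl (Sum.inl _), Sum.inr (Sum.inl _) => True
    | _, _ => False

/-- `v` is a cut vertex of `G`: two other vertices are connected in `G` but not in `G - v`. -/
def IsCutVertex {α : Type*} (G : SimpleGraph α) (v : α) : Prop :=
  ∃ a b : ↥{u : α | u ≠ v}, G.Reachable a.1 b.1 ∧
    ¬ (G.induce {u : α | u ≠ v}).Reachable a b

/-- `G.induce S` is an end block of `G`: a maximal 2-connected (induced) subgraph
containing at most one cut vertex of `G`. -/
def IsEndBlockOn {α : Type*} (G : SimpleGraph α) (S : Set α) : Prop :=
  TwoConnected (G.induce S) ∧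
  (∀ T : Set α, S ⊆ T → TwoConnected (G.induce T) → T = S) ∧
  {v ∈ S | IsCutVertex G v}.Subsingleton

/-- Some path of `G` from `u` to `v` has vertex set exactly `S`. -/
def PathOn {V : Type*} (G : SimpleGraph V) (S : Finset V) (u v : V) : Prop :=
  ∃ p : G.Walk u v, p.IsPath ∧ ∀ x, x ∈ p.support ↔ x ∈ S

namespace PathOn

variable {V : Type*} {G : SimpleGraph V} {S T : Finset V} {u v w z : V}

lemma singleton (u : V) : PathOn G {u} u u :=
  ⟨.nil, by simp, by simp⟩

lemma symm (h : PathOn G S u v) : PathOn G S v u := by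
  obtain ⟨p, hp, hS⟩ := h
  exact ⟨p.reverse, hp.reverse, by simpa using hS⟩

lemma left_mem (h : PathOn G S u v) : u ∈ S := by
  obtain ⟨p, hp, hS⟩ := h
  exact (hS u).1 p.start_mem_support

lemma right_mem (h : PathOn G S u v) : v ∈ S := h.symm.left_mem

lemma cons [DecidableEq V] (hS : PathOn G S u v) (hw : w ∉ S) (h : G.Adj w u) :
    PathOn G (insert w S) w v := by
  obtain ⟨p, hp, hpS⟩ := hS
  exact ⟨.cons h p, by simp [hp, hpS, hw], by simp [hpS]⟩

lemma snoc [DecidableEq V] (hS : PathOn G S u v) (hw : w ∉ S) (h : G.Adj v w) :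
    PathOn G (insert w S) u w :=
  (hS.symm.cons hw h.symm).symm

/-- Gluing two paths at their only common vertex. -/
lemma glue [DecidableEq V] (hS : PathOn G S u v) (hT : PathOn G T v w)
    (h : ∀ x ∈ S, x ∈ T → x = v) : PathOn G (S ∪ T) u w := by
  obtain ⟨p, hp, hpS⟩ := hS
  obtain ⟨q, hq, hqT⟩ := hT
  refine ⟨p.append q, ?_, by simp [hpS, hqT]⟩
  rw [Walk.isPath_def, Walk.support_append, List.nodup_append]
  have hq' := hq.support_nodup
  rw [← Walk.cons_tail_support, List.nodup_cons] at hq'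
  refine ⟨hp.support_nodup, hq'.2, ?_⟩
  rintro x hx y hy rfl
  have hxv := h x ((hpS x).1 hx) ((hqT x).1 (List.mem_of_mem_tail hy))
  exact hq'.1 (hxv ▸ hy)

/-- Joining two disjoint paths by an edge. -/
lemma join [DecidableEq V] (hS : PathOn G S u v) (hT : PathOn G T w z)
    (hd : ∀ x ∈ S, x ∉ T) (h : G.Adj v w) : PathOn G (S ∪ T) u z := by
  have hv := hS.right_mem
  have := hS.glue (hT.cons (hd v hv) h) (by grind)
  have hST : S ∪ insert v T = S ∪ T := by grind
  rwa [hST] at this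

/-- Cutting a path at one of its vertices. -/
lemma split (hS : PathOn G S u v) (hw : w ∈ S) :
    ∃ S₁ S₂ : Finset V, PathOn G S₁ u w ∧ PathOn G S₂ w v ∧ S₁ ⊆ S ∧ S₂ ⊆ S ∧
      ∀ x ∈ S₁, x ∈ S₂ → x = w := by
  classical
  obtain ⟨p, hp, hpS⟩ := hS
  have hwp := (hpS w).2 hw
  refine ⟨(p.takeUntil w hwp).support.toFinset, (p.dropUntil w hwp).support.toFinset,
    ⟨_, hp.takeUntil hwp, by simp⟩, ⟨_, hp.dropUntil hwp, by simp⟩, ?_, ?_, ?_⟩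
  · intro x hx
    exact (hpS x).1 (p.support_takeUntil_subset_support hwp (by simpa using hx))
  · intro x hx
    exact (hpS x).1 (p.support_dropUntil_subset_support hwp (by simpa using hx))
  · intro x hx hy
    rw [List.mem_toFinset] at hx hy
    have hn := hp.support_nodup
    rw [← p.take_spec hwp, Walk.support_append, List.nodup_append] at hn
    rw [← Walk.cons_tail_support, List.mem_cons] at hy
    rcases hy with rfl | hy
    · rfl
    · exact (hn.2.2 x hx x hy rfl).elim

/-- A path listed by its successive vertices. -/
lemma exists_enum (hS : PathOn G S u v) :
    ∃ (x : ℕ → V) (m : ℕ), x 0 = u ∧ x m = v ∧ (∀ i ≤ m, ∀ j ≤ m, x i = x j → i = j) ∧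
      (∀ i < m, G.Adj (x i) (x (i + 1))) ∧ ∀ y, y ∈ S ↔ ∃ i ≤ m, x i = y := by
  obtain ⟨p, hp, hpS⟩ := hS
  refine ⟨p.getVert, p.length, by simp, by simp, ?_, fun i hi => p.adj_getVert_succ hi, ?_⟩
  · intro i hi j hj h
    exact hp.getVert_injOn hi hj h
  · intro y
    rw [← hpS, Walk.mem_support_iff_exists_getVert]
    exact ⟨fun ⟨i, h, hi⟩ => ⟨i, hi, h⟩, fun ⟨i, hi, h⟩ => ⟨i, h, hi⟩⟩

/-- A segment of an enumerated path. -/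
lemma segment [DecidableEq V] {x : ℕ → V} {m : ℕ}
    (hinj : ∀ i ≤ m, ∀ j ≤ m, x i = x j → i = j) (hadj : ∀ i < m, G.Adj (x i) (x (i + 1)))
    {i j : ℕ} (hij : i ≤ j) (hj : j ≤ m) : PathOn G ((Finset.Icc i j).image x) (x i) (x j) := by
  induction j, hij using Nat.le_induction with
  | base => simpa using singleton (x i)
  | succ j hij ih =>
    have h := (ih (by omega)).snoc (w := x (j + 1)) ?_ (hadj j (by omega))
    · rwa [← Finset.image_insert, Finset.insert_Icc_right_eq_Icc_add_one (by omega)] at h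
    · intro hmem
      obtain ⟨t, ht, hxt⟩ := Finset.mem_image.1 hmem
      rw [Finset.mem_Icc] at ht
      have := hinj t (by omega) (j + 1) hj hxt
      omega

/-- Deleting the last vertex of a nontrivial path. -/
lemma exists_pred [DecidableEq V] (hS : PathOn G S u v) (huv : u ≠ v) :
    ∃ w, PathOn G (S.erase v) u w ∧ G.Adj w v := by
  obtain ⟨x, m, rfl, rfl, hinj, hadj, hmem⟩ := hS.exists_enum
  obtain _ | m := m
  · exact absurd rfl huv
  refine ⟨x m, ?_, hadj m (by omega)⟩
  have h := segment hinj hadj (Nat.zero_le m) (by omega)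
  convert! h
  ext y
  rw [Finset.mem_erase, hmem, Finset.mem_image]
  constructor
  · rintro ⟨hne, i, hi, rfl⟩
    refine ⟨i, ?_, rfl⟩
    have : i ≠ m + 1 := fun h => hne (h ▸ rfl)
    rw [Finset.mem_Icc]
    omega
  · rintro ⟨i, hi, rfl⟩
    rw [Finset.mem_Icc] at hi
    refine ⟨fun h => ?_, i, by omega, rfl⟩
    have := hinj i (by omega) (m + 1) le_rfl h
    omega

/-- Closing a path to a cycle. -/
lemma card_le_circumference [Fintype V] (hS : PathOn G S u v) (h : G.Adj v u)
    (h3 : 3 ≤ S.card) : S.card ≤ circumference G := by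
  classical
  obtain ⟨p, hp, hpS⟩ := hS
  have hlen : p.length + 1 = S.card := by
    rw [← Walk.length_support, ← List.toFinset_card_of_nodup hp.support_nodup]
    congr 1
    ext x
    simp [hpS]
  refine le_csSup ⟨Fintype.card V, ?_⟩ ⟨v, .cons h p, ?_, by simpa using hlen⟩
  · rintro n ⟨v, w, hw, rfl⟩
    have := hw.support_nodup.length_le_card
    simpa using this
  · rw [Walk.cons_isCycle_iff]
    refine ⟨hp, fun he => ?_⟩
    have := hp.length_eq_one_of_mem_edges (Sym2.eq_swap ▸ he)
    omega

/-- Two paths with the same ends and otherwise disjoint form a cycle. -/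
lemma card_le_circumference_of_pair [Fintype V] (hS : PathOn G S u v) (hT : PathOn G T u v)
    (huv : u ≠ v) (hST : ∀ x ∈ S, x ∈ T → x = u ∨ x = v) (h3 : 3 ≤ S.card) :
    S.card ≤ circumference G := by
  classical
  obtain ⟨w, hw, hwv⟩ := hT.exists_pred huv
  have hle := Finset.card_le_card (Finset.subset_union_left : S ⊆ S ∪ T.erase v)
  exact hle.trans ((hS.symm.glue hw (by grind)).card_le_circumference hwv (h3.trans hle))

end PathOn

namespace TwoConnected

variable {V : Type*} {G : SimpleGraph V}

/-- An edge leaving a set of vertices and avoiding a given vertex. -/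
lemma exists_boundary (hG : TwoConnected G) {S : Set V} {c s t : V} (hs : s ∈ S) (ht : t ∉ S)
    (hsc : s ≠ c) (htc : t ≠ c) : ∃ a ∈ S, ∃ b ∉ S, a ≠ c ∧ b ≠ c ∧ G.Adj a b := by
  obtain ⟨p⟩ := (hG.2 c).preconnected ⟨s, hsc⟩ ⟨t, htc⟩
  obtain ⟨d, -, h1, h2⟩ := p.exists_boundary_dart (Subtype.val ⁻¹' S) hs ht
  exact ⟨d.fst, h1, d.snd, h2, d.fst.2, d.snd.2, d.adj⟩

/-- A shortest path between two sets of vertices avoiding a given vertex. -/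
lemma exists_pathOn (hG : TwoConnected G) {X Y : Set V} {c s t : V} (hs : s ∈ X) (ht : t ∈ Y)
    (hsc : s ≠ c) (htc : t ≠ c) : ∃ (U : Finset V) (w z : V), PathOn G U w z ∧ w ∈ X ∧ z ∈ Y ∧
      c ∉ U ∧ (∀ x ∈ U, x ∈ X → x = w) ∧ ∀ x ∈ U, x ∈ Y → x = z := by
  classical
  let P : ℕ → Prop := fun n => ∃ (U : Finset V) (w z : V), PathOn G U w z ∧ w ∈ X ∧ z ∈ Y ∧
    c ∉ U ∧ U.card = n
  have hP : ∃ n, P n := by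
    obtain ⟨p, hp⟩ := (hG.2 c).preconnected.exists_isPath ⟨s, hsc⟩ ⟨t, htc⟩
    let q : G.Walk s t := p.map (Embedding.induce _).toHom
    refine ⟨_, q.support.toFinset, s, t, ⟨q, ?_, by simp⟩, hs, ht, ?_, rfl⟩
    · exact Walk.IsPath.map Subtype.val_injective hp
    · intro hcq
      have hcq' : c ∈ (p.map (Embedding.induce _).toHom).support := List.mem_toFinset.1 hcq
      rw [Walk.support_map, List.mem_map] at hcq'
      obtain ⟨y, -, hy⟩ := hcq'
      exact y.2 hy
  obtain ⟨U, w, z, hU, hw, hz, hc, hcard⟩ := Nat.find_spec hP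
  refine ⟨U, w, z, hU, hw, hz, hc, ?_, ?_⟩
  · intro x hx hxX
    by_contra hne
    obtain ⟨U₁, U₂, h1, h2, hs1, hs2, hd⟩ := hU.split hx
    have hlt : U₂ ⊂ U := ⟨hs2, fun h => hne (hd w h1.left_mem (h hU.left_mem)).symm⟩
    exact Nat.find_min hP (hcard ▸ Finset.card_lt_card hlt)
      ⟨U₂, x, z, h2, hxX, hz, fun h => hc (hs2 h), rfl⟩
  · intro x hx hxY
    by_contra hne
    obtain ⟨U₁, U₂, h1, h2, hs1, hs2, hd⟩ := hU.split hx
    have hlt : U₁ ⊂ U := ⟨hs1, fun h => hne (hd z (h hU.right_mem) h2.right_mem).symm⟩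
    exact Nat.find_min hP (hcard ▸ Finset.card_lt_card hlt)
      ⟨U₁, w, x, h1, hw, hxY, fun h => hc (hs1 h), rfl⟩

lemma exists_ne (hG : TwoConnected G) (a b : V) : ∃ c, c ≠ a ∧ c ≠ b := by
  classical
  by_contra! h
  have h3 := hG.1
  have : (Set.univ : Set V) ⊆ ({a, b} : Finset V) := by
    intro c _
    by_cases hc : c = a
    · simp [hc]
    · simp [h c hc]
  have h2 := Set.ncard_le_ncard this (Finset.finite_toSet _)
  rw [Set.ncard_univ, Set.ncard_coe_finset] at h2
  have := Finset.card_le_two (a := a) (b := b)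
  omega

lemma exists_adj_ne (hG : TwoConnected G) (v c : V) : ∃ w, w ≠ c ∧ G.Adj v w := by
  by_cases hvc : v = c
  · obtain ⟨d, hd, -⟩ := hG.exists_ne v v
    obtain ⟨e, he, hed⟩ := hG.exists_ne v d
    obtain ⟨a, rfl, b, hb, -, -, hab⟩ :=
      hG.exists_boundary (S := {v}) (c := d) rfl he hd.symm hed
    exact ⟨b, hvc ▸ hb, hab⟩
  · obtain ⟨d, hd, hdc⟩ := hG.exists_ne v c
    obtain ⟨a, rfl, b, hb, -, hbc, hab⟩ :=
      hG.exists_boundary (S := {v}) (c := c) rfl hd hvc hdc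
    exact ⟨b, hbc, hab⟩

lemma two_le_gdeg [Finite V] (hG : TwoConnected G) (v : V) : 2 ≤ gdeg G v := by
  obtain ⟨a, -, ha⟩ := hG.exists_adj_ne v v
  obtain ⟨b, hb, hb'⟩ := hG.exists_adj_ne v a
  exact (Set.one_lt_ncard (Set.toFinite _)).2 ⟨a, ha, b, hb', hb.symm⟩

end TwoConnected

/-- Two disjoint paths run from `A` to `B`, each meeting `A` and `B` only in its ends; one of them
starts at `a` and one of them ends at `b`. -/
def LinkedBy {V : Type*} (G : SimpleGraph V) (A B : Set V) (a b : V) : Prop :=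
  ∃ (S T : Finset V) (s₁ s₂ t : V), PathOn G S s₁ b ∧ PathOn G T s₂ t ∧ (∀ x ∈ S, x ∉ T) ∧
    s₁ ∈ A ∧ s₂ ∈ A ∧ b ∈ B ∧ t ∈ B ∧ (s₁ = a ∨ s₂ = a) ∧
    (∀ x ∈ S, x ∈ A → x = s₁) ∧ (∀ x ∈ T, x ∈ A → x = s₂) ∧
    (∀ x ∈ S, x ∈ B → x = b) ∧ ∀ x ∈ T, x ∈ B → x = t

namespace TwoConnected

variable {V : Type*} {G : SimpleGraph V}

/-- A linkage starting with a trivial path. -/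
lemma linkedBy_self (hG : TwoConnected G) {A B : Set V} {a a' b' : V} (ha : a ∈ A) (hb : a ∈ B)
    (ha' : a' ∈ A) (hb' : b' ∈ B) (haa' : a' ≠ a) (hab' : b' ≠ a) : LinkedBy G A B a a := by
  obtain ⟨U, w, z, hU, hw, hz, haU, hUA, hUB⟩ := hG.exists_pathOn ha' hb' haa' hab'
  exact ⟨{a}, U, a, w, z, .singleton a, hU, by simpa using haU, ha, hw, hb, hz, .inl rfl,
    by simp, hUA, by simp, hUB⟩

/-- Moving the end of a linkage along an edge, when `b` is removed from the target set. -/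
lemma linkedBy_step (hG : TwoConnected G) {A B : Set V} {a b c d : V}
    (h : LinkedBy G A (insert b B) a b) (hb : b ∉ B) (hc : c ∈ B) (hcA : c ∉ A) (hd : d ∈ B)
    (hdc : d ≠ c) (hbc : G.Adj b c) : LinkedBy G A B a c := by
  classical
  obtain ⟨S, T, s₁, s₂, t, hS, hT, hST, hs₁, hs₂, -, ht, ha, hSA, hTA, hSB, hTB⟩ := h
  have hcS : c ∉ S := fun h => hbc.ne (hSB c h (.inr hc)).symm
  have hS' := hS.snoc hcS hbc
  have hSB' : ∀ x ∈ S, x ∉ B := fun x hx hxB => hb (hSB x hx (.inr hxB) ▸ hxB)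
  have htb : t ≠ b := fun h => hST b hS.right_mem (h ▸ hT.right_mem)
  have htB : t ∈ B := ht.resolve_left htb
  have hTB' : ∀ x ∈ T, x ∈ B → x = t := fun x hx hxB => hTB x hx (.inr hxB)
  have hS'A : ∀ x ∈ insert c S, x ∈ A → x = s₁ := by grind
  have hS'B : ∀ x ∈ insert c S, x ∈ B → x = c := by grind
  by_cases htc : t = c
  swap
  · refine ⟨insert c S, T, s₁, s₂, t, hS', hT, ?_, hs₁, hs₂, hc, htB, ha, hS'A, hTA, hS'B, hTB'⟩
    grind
  subst htc
  have hs₁c : s₁ ≠ t := fun h => hcA (h ▸ hs₁)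
  obtain ⟨U, w, z, hU, hw, hz, hcU, hUX, hUY⟩ :=
    hG.exists_pathOn (X := {x | x ∈ S ∨ x ∈ T ∨ x ∈ A}) (Y := B) (.inl hS.left_mem) hd hs₁c hdc
  have hwU := hU.left_mem
  by_cases hwS : w ∈ S
  · obtain ⟨S₁, S₂, h1, -, hs1, -, -⟩ := hS.split hwS
    refine ⟨T, S₁ ∪ U, s₂, s₁, z, hT, h1.glue hU fun x hx hxU => hUX x hxU (.inl (hs1 hx)), ?_,
      hs₂, hs₁, hc, hz, ha.symm, hTA, ?_, hTB', ?_⟩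
    · grind
    · grind
    · grind
  by_cases hwT : w ∈ T
  · obtain ⟨T₁, T₂, h1, h2, hs1, -, hd⟩ := hT.split hwT
    have htT₁ : t ∉ T₁ := fun h => hcU (hd t h h2.right_mem ▸ hwU)
    refine ⟨insert t S, T₁ ∪ U, s₁, s₂, z, hS',
      h1.glue hU fun x hx hxU => hUX x hxU (.inr (.inl (hs1 hx))), ?_,
      hs₁, hs₂, hc, hz, ha, hS'A, ?_, hS'B, ?_⟩
    · grind
    · grind
    · grind
  have hwA : w ∈ A := (hw.resolve_left hwS).resolve_left hwT
  have hUA : ∀ x ∈ U, x ∈ A → x = w := fun x hx hxA => hUX x hx (.inr (.inr hxA))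
  have hUS : ∀ x ∈ S, x ∉ U := fun x hx hxU => hwS (hUX x hxU (.inl hx) ▸ hx)
  have hUT : ∀ x ∈ T, x ∉ U := fun x hx hxU => hwT (hUX x hxU (.inr (.inl hx)) ▸ hx)
  rcases ha with ha | ha
  · refine ⟨insert t S, U, s₁, w, z, hS', hU, ?_, hs₁, hwA, hc, hz, .inl ha, hS'A, hUA, hS'B, hUY⟩
    grind
  · exact ⟨T, U, s₂, w, z, hT, hU, hUT, hs₂, hwA, hc, hz, .inl ha, hTA, hUA, hTB', hUY⟩

/-- Linking the initial segment up to `a` of a path with its final segment from `b`. -/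
lemma linkedBy_segments (hG : TwoConnected G) {x : ℕ → V} {m a b : ℕ}
    (hinj : ∀ i ≤ m, ∀ j ≤ m, x i = x j → i = j) (hadj : ∀ i < m, G.Adj (x i) (x (i + 1)))
    (ha : 0 < a) (hab : a ≤ b) (hb : b < m) :
    LinkedBy G (x '' Set.Icc 0 a) (x '' Set.Icc b m) (x a) (x b) := by
  induction b, hab using Nat.le_induction with
  | base =>
    refine hG.linkedBy_self (a' := x 0) (b' := x m) ⟨a, by simp⟩ ⟨a, by simp; omega⟩
      ⟨0, by simp⟩ ⟨m, by simp; omega⟩ ?_ ?_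
    · exact fun h => by have := hinj 0 (by omega) a (by omega) h; omega
    · exact fun h => by have := hinj m (by omega) a (by omega) h; omega
  | succ b hab ih =>
    have hins : x '' Set.Icc b m = insert (x b) (x '' Set.Icc (b + 1) m) := by
      rw [← Set.image_insert_eq]
      congr 1
      ext i
      simp only [Set.mem_Icc, Set.mem_insert_iff]
      omega
    have h := ih (by omega)
    rw [hins] at h
    refine hG.linkedBy_step (d := x m) h ?_ ⟨b + 1, by simp; omega⟩ ?_ ⟨m, by simp; omega⟩ ?_
      (hadj b (by omega))
    · rintro ⟨i, hi, h⟩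
      have := hinj i hi.2 b (by omega) h
      exact absurd hi.1 (by omega)
    · rintro ⟨i, hi, h⟩
      have := hinj i (hi.2.trans (by omega)) (b + 1) (by omega) h
      exact absurd hi.2 (by omega)
    · intro h
      have := hinj m le_rfl (b + 1) (by omega) h
      omega

end TwoConnected

namespace PathOn

variable {V : Type*} {G : SimpleGraph V}

lemma exists_longest [Finite V] [Nonempty V] (G : SimpleGraph V) :
    ∃ (S : Finset V) (u v : V), PathOn G S u v ∧ ∀ T u v, PathOn G T u v → T.card ≤ S.card := by
  classical
  have := Fintype.ofFinite V
  obtain ⟨r⟩ := ‹Nonempty V›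
  obtain ⟨S, hS, hmax⟩ := (Finset.univ.filter fun S => ∃ u v, PathOn G S u v).exists_max_image
    Finset.card ⟨{r}, by simpa using ⟨r, r, .singleton r⟩⟩
  obtain ⟨u, v, h⟩ := (Finset.mem_filter.1 hS).2
  exact ⟨S, u, v, h, fun T u v hT => hmax T (by simpa using ⟨u, v, hT⟩)⟩

/-- All neighbours of an end of a longest path lie on the path. -/
lemma mem_of_adj {S : Finset V} {u v w : V} (hS : PathOn G S u v)
    (hmax : ∀ T u v, PathOn G T u v → T.card ≤ S.card) (h : G.Adj u w) : w ∈ S := by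
  classical
  by_contra hw
  have := hmax _ _ _ (hS.cons hw h.symm)
  rw [Finset.card_insert_of_notMem hw] at this
  omega

/-- A longest path can be rotated so that it does not start at a given vertex. -/
lemma exists_rotation (hG : TwoConnected G) {S : Finset V} {u v : V} (hS : PathOn G S u v)
    (hmax : ∀ T u v, PathOn G T u v → T.card ≤ S.card) (y : V) :
    ∃ u', u' ≠ y ∧ PathOn G S u' v := by
  classical
  by_cases huy : u = y
  swap
  · exact ⟨u, huy, hS⟩
  obtain ⟨x, m, hx0, hxm, hinj, hadj, hmem⟩ := hS.exists_enum
  obtain ⟨w, hw1, hw⟩ := hG.exists_adj_ne u (x 1)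
  obtain ⟨i, him, rfl⟩ := (hmem w).1 (hS.mem_of_adj hmax hw)
  obtain _ | _ | i := i
  · exact absurd hx0 hw.ne'
  · exact absurd rfl hw1
  refine ⟨x (i + 1), fun h => ?_, ?_⟩
  · have := hinj (i + 1) (by omega) 0 (by omega) (by rw [h, hx0, huy])
    omega
  · have h1 := segment hinj hadj (Nat.zero_le (i + 1)) (by omega)
    have h2 := segment hinj hadj him le_rfl
    have h := h1.symm.join h2 ?_ (hx0 ▸ hw)
    · rw [hxm] at h
      convert! h
      ext z
      rw [hmem, Finset.mem_union, Finset.mem_image, Finset.mem_image]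
      constructor
      · rintro ⟨j, hj, rfl⟩
        by_cases hji : j ≤ i + 1
        · exact .inl ⟨j, by simpa using hji, rfl⟩
        · exact .inr ⟨j, by rw [Finset.mem_Icc]; omega, rfl⟩
      · rintro (⟨j, hj, rfl⟩ | ⟨j, hj, rfl⟩) <;> rw [Finset.mem_Icc] at hj <;>
          exact ⟨j, by omega, rfl⟩
    · intro z hz hz'
      obtain ⟨j, hj, rfl⟩ := Finset.mem_image.1 hz
      obtain ⟨l, hl, hjl⟩ := Finset.mem_image.1 hz'
      rw [Finset.mem_Icc] at hj hl
      have := hinj l (by omega) j (by omega) hjl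
      omega

/-- A longest path whose ends are adjacent is spanning. -/
lemma eq_univ_of_adj [Fintype V] (hG : TwoConnected G) {S : Finset V} {u v : V}
    (hS : PathOn G S u v) (hmax : ∀ T u v, PathOn G T u v → T.card ≤ S.card) (h : G.Adj v u) :
    S = Finset.univ := by
  classical
  by_contra hne
  obtain ⟨t, ht⟩ : ∃ t, t ∉ S := by simpa [Finset.eq_univ_iff_forall] using hne
  obtain ⟨a, ha, b, hb, -, -, hab⟩ := hG.exists_boundary (S := S) (c := v) hS.left_mem ht h.ne'
    (fun h => ht (h ▸ hS.right_mem))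
  obtain ⟨x, m, rfl, rfl, hinj, hadj, hmem⟩ := hS.exists_enum
  obtain ⟨i, hi, rfl⟩ := (hmem a).1 ha
  suffices H : ∃ u, PathOn G S u (x i) by
    obtain ⟨u, hu⟩ := H
    have := hmax _ _ _ (hu.snoc hb hab)
    rw [Finset.card_insert_of_notMem hb] at this
    omega
  obtain rfl | hlt := hi.eq_or_lt
  · exact ⟨_, hS⟩
  have h1 := segment hinj hadj (Nat.zero_le i) hi
  have h2 := segment hinj hadj (Nat.succ_le_of_lt hlt) le_rfl
  refine ⟨_, (congrArg (PathOn G · _ _) ?_).mp (h2.join h1 ?_ h)⟩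
  · ext z
    rw [hmem, Finset.mem_union, Finset.mem_image, Finset.mem_image]
    constructor
    · rintro (⟨j, hj, rfl⟩ | ⟨j, hj, rfl⟩) <;> rw [Finset.mem_Icc] at hj <;>
        exact ⟨j, by omega, rfl⟩
    · rintro ⟨j, hj, rfl⟩
      by_cases hji : j ≤ i
      · exact .inr ⟨j, by simpa using hji, rfl⟩
      · exact .inl ⟨j, by rw [Finset.mem_Icc]; omega, rfl⟩
  · intro z hz hz'
    obtain ⟨j, hj, rfl⟩ := Finset.mem_image.1 hz
    obtain ⟨l, hl, hjl⟩ := Finset.mem_image.1 hz'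
    rw [Finset.mem_Icc] at hj hl
    have := hinj l (by omega) j (by omega) hjl
    omega

/-- Two crossing chords from the ends of a path turn its initial and final segments into a path
with adjacent ends. -/
lemma of_crossing [DecidableEq V] {x : ℕ → V} {m i j : ℕ}
    (hinj : ∀ i ≤ m, ∀ j ≤ m, x i = x j → i = j) (hadj : ∀ i < m, G.Adj (x i) (x (i + 1)))
    (hij : i < j) (hjm : j ≤ m) (hi : G.Adj (x m) (x i)) :
    PathOn G ((Finset.Icc 0 i ∪ Finset.Icc j m).image x) (x 0) (x j) := by
  rw [Finset.image_union]
  refine (segment hinj hadj (Nat.zero_le i) (by omega)).join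
    (segment hinj hadj hjm le_rfl).symm ?_ hi.symm
  intro z hz hz'
  obtain ⟨s, hs, rfl⟩ := Finset.mem_image.1 hz
  obtain ⟨l, hl, hsl⟩ := Finset.mem_image.1 hz'
  rw [Finset.mem_Icc] at hs hl
  have := hinj l (by omega) s (by omega) hsl
  omega

/-- In the initial segment of a path closed by a chord from its first vertex, a path between the
end of that segment and any other vertex that covers all neighbours of the first vertex. -/
lemma exists_detour [DecidableEq V] {x : ℕ → V} {m a q : ℕ}
    (hinj : ∀ i ≤ m, ∀ j ≤ m, x i = x j → i = j) (hadj : ∀ i < m, G.Adj (x i) (x (i + 1)))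
    (ham : a ≤ m) (hqa : q < a) (h : G.Adj (x 0) (x a)) :
    ∃ L : Finset V, PathOn G L (x a) (x q) ∧ (∀ y ∈ L, ∃ i ≤ a, x i = y) ∧ x 0 ∈ L ∧
      ∀ i ≤ a, G.Adj (x 0) (x i) → x i ∈ L := by
  classical
  have hex : ∃ r, q < r ∧ G.Adj (x 0) (x r) := ⟨a, hqa, h⟩
  obtain ⟨hqr, hr⟩ := Nat.find_spec hex
  have hra : Nat.find hex ≤ a := Nat.find_min' hex ⟨hqa, h⟩
  have hmin : ∀ i, q < i → G.Adj (x 0) (x i) → Nat.find hex ≤ i :=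
    fun i h1 h2 => Nat.find_min' hex ⟨h1, h2⟩
  generalize Nat.find hex = r at *
  refine ⟨_, (segment hinj hadj hra ham).symm.join
    (segment hinj hadj (Nat.zero_le q) (by omega)) ?_ hr.symm, ?_, ?_, ?_⟩
  · intro z hz hz'
    obtain ⟨s, hs, rfl⟩ := Finset.mem_image.1 hz
    obtain ⟨l, hl, hsl⟩ := Finset.mem_image.1 hz'
    rw [Finset.mem_Icc] at hs hl
    have := hinj l (by omega) s (by omega) hsl
    omega
  · intro y hy
    rw [Finset.mem_union, Finset.mem_image, Finset.mem_image] at hy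
    rcases hy with ⟨i, hi, rfl⟩ | ⟨i, hi, rfl⟩ <;> rw [Finset.mem_Icc] at hi <;>
      exact ⟨i, by omega, rfl⟩
  · exact Finset.mem_union_right _ (Finset.mem_image.2 ⟨0, by simp, rfl⟩)
  · intro i hia hi
    by_cases hiq : i ≤ q
    · exact Finset.mem_union_right _ (Finset.mem_image.2 ⟨i, by simpa using hiq, rfl⟩)
    · exact Finset.mem_union_left _
        (Finset.mem_image.2 ⟨i, Finset.mem_Icc.2 ⟨hmin i (by omega) hi, hia⟩, rfl⟩)

end PathOn

namespace TwoConnected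

variable {V : Type*} {G : SimpleGraph V}

/-- A long cycle from a path whose end vertices have no crossing chords. -/
lemma le_circumference_of_noncrossing [Fintype V] (hG : TwoConnected G) {x : ℕ → V}
    {m a b k : ℕ} (hinj : ∀ i ≤ m, ∀ j ≤ m, x i = x j → i = j)
    (hadj : ∀ i < m, G.Adj (x i) (x (i + 1))) (hk : 2 ≤ k) {I J : Finset ℕ}
    (hI : ∀ i ∈ I, 0 < i ∧ i ≤ a ∧ G.Adj (x 0) (x i))
    (hJ : ∀ j ∈ J, b ≤ j ∧ j < m ∧ G.Adj (x m) (x j))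
    (hIk : k ≤ I.card) (hJk : k ≤ J.card) (ha : a ∈ I) (hb : b ∈ J) (hab : a ≤ b) :
    2 * k ≤ circumference G := by
  classical
  obtain ⟨ha0, -, hxa⟩ := hI a ha
  obtain ⟨-, hbm, hxb⟩ := hJ b hb
  obtain ⟨S, T, s₁, s₂, t, hS, hT, hST, hs₁, hs₂, -, ht, hsa, hSA, hTA, hSB, hTB⟩ :=
    hG.linkedBy_segments hinj hadj ha0 hab hbm
  have hs₁₂ : s₁ ≠ s₂ := fun h => hST s₁ hS.left_mem (h ▸ hT.left_mem)
  have htb : t ≠ x b := fun h => hST _ hS.right_mem (h ▸ hT.right_mem)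
  have hAB : ∀ y ∈ x '' Set.Icc 0 a, y ∈ x '' Set.Icc b m → y = x b := by
    rintro _ ⟨i, hi, rfl⟩ ⟨j, hj, hji⟩
    have := hinj j hj.2 i (hi.2.trans (by omega)) hji
    have hib : i = b := by
      have := hi.2
      have := hj.1
      omega
    rw [hib]
  obtain ⟨L, hL, hLA, hL0, hLI⟩ : ∃ L : Finset V, PathOn G L s₂ s₁ ∧
      (∀ y ∈ L, y ∈ x '' Set.Icc 0 a) ∧ x 0 ∈ L ∧ ∀ i ∈ I, x i ∈ L := by
    have key : ∀ s ∈ x '' Set.Icc 0 a, s ≠ x a → ∃ L : Finset V, PathOn G L (x a) s ∧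
        (∀ y ∈ L, y ∈ x '' Set.Icc 0 a) ∧ x 0 ∈ L ∧ ∀ i ∈ I, x i ∈ L := by
      rintro _ ⟨q, hq, rfl⟩ hqa
      have hlt : q < a := lt_of_le_of_ne hq.2 fun h => hqa (h ▸ rfl)
      obtain ⟨L, hL, hLA, hL0, hLI⟩ := PathOn.exists_detour hinj hadj (by omega) hlt hxa
      refine ⟨L, hL, fun y hy => ?_, hL0, fun i hi => hLI i (hI i hi).2.1 (hI i hi).2.2⟩
      obtain ⟨i, hi, rfl⟩ := hLA y hy
      exact ⟨i, ⟨Nat.zero_le i, hi⟩, rfl⟩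
    rcases hsa with rfl | rfl
    · obtain ⟨L, hL, h⟩ := key s₂ hs₂ hs₁₂.symm
      exact ⟨L, hL.symm, h⟩
    · exact key s₁ hs₁ hs₁₂
  obtain ⟨R, hR, hRB, hRm, hRJ⟩ : ∃ R : Finset V, PathOn G R (x b) t ∧
      (∀ y ∈ R, y ∈ x '' Set.Icc b m) ∧ x m ∈ R ∧ ∀ j ∈ J, x j ∈ R := by
    obtain ⟨p, hp, rfl⟩ := ht
    have hpm : p ≤ m := hp.2
    have hlt : b < p := lt_of_le_of_ne hp.1 fun h => htb (h ▸ rfl)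
    obtain ⟨R, hR, hRB, hRm, hRJ⟩ := PathOn.exists_detour (G := G) (x := fun i => x (m - i))
      (m := m) (a := m - b) (q := m - p)
      (fun i hi j hj h => by have := hinj _ (Nat.sub_le m i) _ (Nat.sub_le m j) h; omega)
      (fun i hi => by
        have h := hadj (m - (i + 1)) (by omega)
        rw [show m - (i + 1) + 1 = m - i by omega] at h
        exact h.symm)
      (by omega) (by omega) (by simpa [Nat.sub_sub_self hbm.le] using hxb)
    simp only [Nat.sub_sub_self hbm.le, Nat.sub_sub_self hpm, Nat.sub_zero] at hR hRm hRJ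
    refine ⟨R, hR, fun y hy => ?_, hRm, fun j hj => ?_⟩
    · obtain ⟨i, hi, rfl⟩ := hRB y hy
      exact ⟨m - i, ⟨by omega, by omega⟩, rfl⟩
    · obtain ⟨hbj, hjm, hxj⟩ := hJ j hj
      have h := hRJ (m - j) (by omega)
      rw [Nat.sub_sub_self hjm.le] at h
      exact h hxj
  have hLS := hL.glue hS fun y hy hyS => hSA y hyS (hLA y hy)
  have hM := hLS.glue hR fun y hy hyR => by
    rcases Finset.mem_union.1 hy with hy | hy
    · exact hAB y (hLA y hy) (hRB y hyR)
    · exact hSB y hy (hRB y hyR)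
  have hcard : 2 * k + 1 ≤ (L ∪ S ∪ R).card := by
    have h0 : 0 ∉ I := fun h => (hI 0 h).1.ne rfl
    have hm : m ∉ J := fun h => (hJ m h).2.1.ne rfl
    have hinter : insert 0 I ∩ insert m J ⊆ {a} := by
      intro i hi
      rw [Finset.mem_inter, Finset.mem_insert, Finset.mem_insert] at hi
      rw [Finset.mem_singleton]
      have h1 : i ≤ a := hi.1.elim (by omega) fun h => (hI i h).2.1
      have h2 : b ≤ i := hi.2.elim (by omega) fun h => (hJ i h).1
      omega
    have hle := Finset.card_le_card hinter
    have hun := Finset.card_union_add_card_inter (insert 0 I) (insert m J)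
    rw [Finset.card_insert_of_notMem h0, Finset.card_insert_of_notMem hm] at hun
    rw [Finset.card_singleton] at hle
    have himg : ((insert 0 I ∪ insert m J).image x).card = (insert 0 I ∪ insert m J).card := by
      refine Finset.card_image_of_injOn fun i hi j hj h => ?_
      have hlem : ∀ i ∈ insert 0 I ∪ insert m J, i ≤ m := by
        intro i hi
        rw [Finset.mem_union, Finset.mem_insert, Finset.mem_insert] at hi
        rcases hi with (rfl | hi) | (rfl | hi)
        · omega
        · have := (hI i hi).2.1
          omega
        · omega
        · exact (hJ i hi).2.1.le
      exact hinj i (hlem i hi) j (hlem j hj) h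
    have hsub : (insert 0 I ∪ insert m J).image x ⊆ L ∪ S ∪ R := by
      intro y hy
      obtain ⟨i, hi, rfl⟩ := Finset.mem_image.1 hy
      rw [Finset.mem_union, Finset.mem_insert, Finset.mem_insert] at hi
      grind
    have := Finset.card_le_card hsub
    omega
  have hst : s₂ ≠ t := by
    rintro rfl
    exact htb (hAB s₂ hs₂ ht)
  have := hM.card_le_circumference_of_pair hT hst ?_ (by omega)
  · omega
  · intro y hy hyT
    rcases Finset.mem_union.1 hy with hy | hy
    · rcases Finset.mem_union.1 hy with hy | hy
      · exact .inl (hTA y hyT (hLA y hy))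
      · exact (hST y hy hyT).elim
    · exact .inr (hTB y hyT (hRB y hy))

/-- The circumference is bounded below by the degrees of the ends of a longest path. -/
lemma min_le_circumference_of_longest [Fintype V] (hG : TwoConnected G) {S : Finset V} {u v : V}
    {k : ℕ} (hk : 2 ≤ k) (hS : PathOn G S u v)
    (hmax : ∀ T u v, PathOn G T u v → T.card ≤ S.card) (hu : k ≤ gdeg G u) (hv : k ≤ gdeg G v) :
    min (2 * k) (Fintype.card V) ≤ circumference G := by
  classical
  have hu' : ∀ w, G.Adj u w → w ∈ S := fun w => hS.mem_of_adj hmax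
  have hv' : ∀ w, G.Adj v w → w ∈ S := fun w => hS.symm.mem_of_adj hmax
  obtain ⟨x, m, rfl, rfl, hinj, hadj, hmem⟩ := hS.exists_enum
  have hScard : S.card = m + 1 := by
    have : S = (Finset.Icc 0 m).image x := by
      ext y
      simp [hmem]
    rw [this, Finset.card_image_of_injOn, Nat.card_Icc]
    · rfl
    · intro i hi j hj h
      exact hinj i (Finset.mem_Icc.1 hi).2 j (Finset.mem_Icc.1 hj).2 h
  have hdeg : ∀ (v : V) (I : Finset ℕ), k ≤ gdeg G v →
      (∀ w, G.Adj v w → ∃ i ∈ I, x i = w) → k ≤ I.card := by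
    intro v I hv hI
    refine hv.trans (le_trans ?_ (Finset.card_image_le (s := I) (f := x)))
    rw [gdeg, ← Set.ncard_coe_finset]
    refine Set.ncard_le_ncard (fun w hw => ?_) (Finset.finite_toSet _)
    simpa using hI w hw
  let I := (Finset.Icc 1 m).filter fun i => G.Adj (x 0) (x i)
  let J := (Finset.range m).filter fun j => G.Adj (x m) (x j)
  have hI : ∀ i, i ∈ I ↔ (1 ≤ i ∧ i ≤ m) ∧ G.Adj (x 0) (x i) := by simp [I]
  have hJ : ∀ j, j ∈ J ↔ j < m ∧ G.Adj (x m) (x j) := by simp [J]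
  have hIk : k ≤ I.card := by
    refine hdeg _ I hu fun w hw => ?_
    obtain ⟨i, hi, rfl⟩ := (hmem w).1 (hu' w hw)
    have : i ≠ 0 := fun h => hw.ne (h ▸ rfl)
    exact ⟨i, (hI i).2 ⟨⟨by omega, hi⟩, hw⟩, rfl⟩
  have hJk : k ≤ J.card := by
    refine hdeg _ J hv fun w hw => ?_
    obtain ⟨i, hi, rfl⟩ := (hmem w).1 (hv' w hw)
    have : i ≠ m := fun h => hw.ne (h ▸ rfl)
    exact ⟨i, (hJ i).2 ⟨by omega, hw⟩, rfl⟩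
  clear_value I J
  have hIne : I.Nonempty := Finset.card_pos.1 (by omega)
  have hJne : J.Nonempty := Finset.card_pos.1 (by omega)
  by_cases hcross : ∃ d i, i ∈ J ∧ i + d + 1 ∈ I
  swap
  · refine min_le_of_left_le (hG.le_circumference_of_noncrossing hinj hadj hk
      (a := I.max' hIne) (b := J.min' hJne)
      (fun i hi => ⟨((hI i).1 hi).1.1, I.le_max' i hi, ((hI i).1 hi).2⟩)
      (fun j hj => ⟨J.min'_le j hj, (hJ j).1 hj⟩) hIk hJk (I.max'_mem hIne) (J.min'_mem hJne) ?_)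
    by_contra! hlt
    refine hcross ⟨I.max' hIne - J.min' hJne - 1, J.min' hJne, J.min'_mem hJne, ?_⟩
    convert! I.max'_mem hIne using 1
    omega
  obtain ⟨i, hiJ, hiI⟩ := Nat.find_spec hcross
  have hmin : ∀ d' < Nat.find hcross, ∀ i ∈ J, i + d' + 1 ∉ I :=
    fun d' hd' i h1 h2 => Nat.find_min hcross hd' ⟨i, h1, h2⟩
  generalize Nat.find hcross = d at *
  obtain ⟨⟨-, hjm⟩, hxj⟩ := (hI _).1 hiI
  obtain ⟨him, hxi⟩ := (hJ i).1 hiJ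
  have hC := PathOn.of_crossing hinj hadj (by omega : i < i + d + 1) hjm hxi
  have hCcard : ((Finset.Icc 0 i ∪ Finset.Icc (i + d + 1) m).image x).card = m + 1 - d := by
    rw [Finset.card_image_of_injOn, Finset.card_union_of_disjoint, Nat.card_Icc, Nat.card_Icc]
    · omega
    · rw [Finset.disjoint_left]
      intro s hs hs'
      rw [Finset.mem_Icc] at hs hs'
      omega
    · intro s hs t ht h
      simp only [Finset.coe_union, Set.mem_union, Finset.mem_coe, Finset.mem_Icc] at hs ht
      exact hinj s (by omega) t (by omega) h
  obtain rfl | hd := Nat.eq_zero_or_pos d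
  · have huniv := hC.eq_univ_of_adj hG (fun T u v hT => by
      have := hmax T u v hT
      omega) hxj.symm
    have h3 := hG.1
    rw [Nat.card_eq_fintype_card, ← Finset.card_univ, ← huniv] at h3
    refine min_le_of_right_le ?_
    rw [← Finset.card_univ, ← huniv]
    exact hC.card_le_circumference hxj.symm h3
  · have h2k : 2 * k ≤ m + 1 - d := by
      have hdisj : Disjoint I (J.image Nat.succ) := by
        rw [Finset.disjoint_left]
        intro s hs hs'
        obtain ⟨t, ht, rfl⟩ := Finset.mem_image.1 hs'
        exact hmin 0 hd t ht hs
      have hsub : I ∪ J.image Nat.succ ⊆ Finset.Icc 1 (i + 1) ∪ Finset.Icc (i + d + 1) m := by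
        intro s hs
        rw [Finset.mem_union, Finset.mem_Icc, Finset.mem_Icc]
        rcases Finset.mem_union.1 hs with hs | hs
        · have := ((hI s).1 hs).1
          by_contra hcon
          refine hmin (s - i - 1) (by omega) i hiJ ?_
          rwa [show i + (s - i - 1) + 1 = s by omega]
        · obtain ⟨t, ht, rfl⟩ := Finset.mem_image.1 hs
          have := ((hJ t).1 ht).1
          by_contra hcon
          refine hmin (i + d - t) (by omega) t ht ?_
          rwa [show t + (i + d - t) + 1 = i + d + 1 by omega]
      have hle := (Finset.card_le_card hsub).trans (Finset.card_union_le _ _)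
      rw [Finset.card_union_of_disjoint hdisj, Finset.card_image_of_injective _ Nat.succ_injective,
        Nat.card_Icc, Nat.card_Icc] at hle
      omega
    have := hC.card_le_circumference hxj.symm (by omega)
    exact min_le_of_left_le (by omega)

end TwoConnected

/-- Bondy's theorem (Theorem 1.5): a 2-connected graph on `n` vertices in which all but at
most one vertex have degree at least `k` has circumference at least `min {2k, n}`. -/
theorem stmt_9 {V : Type*} [Fintype V] (G : SimpleGraph V) (k : ℕ)
    (h2c : TwoConnected G)
    (hdeg : ∃ y : V, ∀ v : V, v ≠ y → k ≤ gdeg G v) :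
    min (2 * k) (Fintype.card V) ≤ circumference G := by
  obtain ⟨y, hy⟩ := hdeg
  have : Nonempty V := ⟨y⟩
  obtain ⟨S, u, v, hS, hmax⟩ := PathOn.exists_longest G
  obtain ⟨u', hu', hS'⟩ := hS.exists_rotation h2c hmax y
  obtain ⟨v', hv', hS''⟩ := hS'.symm.exists_rotation h2c hmax y
  have h := h2c.min_le_circumference_of_longest (le_max_right k 2) hS'' hmax
    (max_le (hy v' hv') (h2c.two_le_gdeg v')) (max_le (hy u' hu') (h2c.two_le_gdeg u'))
  omega
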